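/- arXiv:2106.05336 — 2 statements merged into one kernel-verified Lean document; each statement's English description precedes it below -/
import Mathlib

section
/- Let F be an algebraically closed field, n > 3, and let s ∈ SL_n(F) be a diagonal matrix with diagonal entries d₁, …, d_n ∈ Fˣ. Assume s is non-central (the dᵢ are not all equal) and non-regular (dᵢ = d_j for some i ≠ j). Then either (a) n = 4 and there is a ∈ Fˣ such that the multiset {d₁, d₂, d₃, d₄} equals {a, a, a⁻¹, a⁻¹} or {a, a, −a⁻¹, −a⁻¹}; or (b) there exist subgroups K and Y of SL_n(F), each normalized by the subgroup T of all diagonal matrices in SL_n(F), such that: every element of K commutes with every element of Y; s commutes with every element of K; s fails to commute with some element of Y; K is isomorphic as an abstract group to SL_2(F); and Y is isomorphic as an abstract group to SL_2(F) or to SL_{n−2}(F). -/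
open Matrix in
/-- The `n × 2` matrix of the inclusion of two coordinates. -/
def inclMat (F : Type*) [Field F] {n : ℕ} (p : Fin 2 → Fin n) : Matrix (Fin n) (Fin 2) F :=
  Matrix.of fun x a => if x = p a then 1 else 0

open Matrix in
lemma inclMat_tr_mul {F : Type*} [Field F] {n : ℕ} (p : Fin 2 → Fin n)
    (hp : Function.Injective p) : (inclMat F p)ᵀ * inclMat F p = 1 := by
  ext a b
  simp [inclMat, Matrix.mul_apply, Matrix.one_apply, hp.eq_iff, eq_comm]

open Matrix in
lemma inclMat_tr_mul_disj {F : Type*} [Field F] {n : ℕ} (p q : Fin 2 → Fin n)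
    (hpq : ∀ a b, p a ≠ q b) : (inclMat F p)ᵀ * inclMat F q = 0 := by
  ext a b
  simp [inclMat, Matrix.mul_apply, (hpq a b).symm]

open Matrix in
lemma diag_mul_inclMat {F : Type*} [Field F] {n : ℕ} (p : Fin 2 → Fin n) (u : Fin n → F) :
    diagonal u * inclMat F p = inclMat F p * diagonal (u ∘ p) := by
  ext a b
  simp only [inclMat, Matrix.diagonal_mul, Matrix.mul_diagonal, Matrix.of_apply, Function.comp]
  split_ifs with h <;> simp [h]

open Matrix in
lemma inclMat_tr_mul_diag {F : Type*} [Field F] {n : ℕ} (p : Fin 2 → Fin n) (u : Fin n → F) :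
    (inclMat F p)ᵀ * diagonal u = diagonal (u ∘ p) * (inclMat F p)ᵀ := by
  have := congrArg Matrix.transpose (diag_mul_inclMat p u)
  simpa [Matrix.transpose_mul] using this

open Matrix in
/-- The embedding of `2 × 2` matrices in the two given coordinates. -/
def embMat {F : Type*} [Field F] {n : ℕ} (p : Fin 2 → Fin n) (g : Matrix (Fin 2) (Fin 2) F) :
    Matrix (Fin n) (Fin n) F := 1 + inclMat F p * (g - 1) * (inclMat F p)ᵀ

open Matrix in
lemma sandwich_mul {F : Type*} [Field F] {n : ℕ} (p q : Fin 2 → Fin n)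
    (A B : Matrix (Fin 2) (Fin 2) F) :
    (inclMat F p * A * (inclMat F p)ᵀ) * (inclMat F q * B * (inclMat F q)ᵀ)
      = inclMat F p * (A * ((inclMat F p)ᵀ * inclMat F q) * B) * (inclMat F q)ᵀ := by
  simp only [Matrix.mul_assoc]

open Matrix in
lemma embMat_mul {F : Type*} [Field F] {n : ℕ} (p : Fin 2 → Fin n)
    (hp : Function.Injective p) (g h : Matrix (Fin 2) (Fin 2) F) :
    embMat p (g * h) = embMat p g * embMat p h := by
  have h1 : g * h - 1 = (g - 1) + (h - 1) + (g - 1) * (h - 1) := by noncomm_ring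
  unfold embMat
  rw [h1, add_mul, mul_add, mul_add, sandwich_mul, inclMat_tr_mul p hp]
  simp only [Matrix.mul_add, Matrix.add_mul, Matrix.mul_one, Matrix.one_mul]
  abel

open Matrix in
lemma embMat_comm {F : Type*} [Field F] {n : ℕ} (p q : Fin 2 → Fin n)
    (hpq : ∀ a b, p a ≠ q b) (g h : Matrix (Fin 2) (Fin 2) F) :
    embMat p g * embMat q h = embMat q h * embMat p g := by
  unfold embMat
  rw [add_mul, mul_add, mul_add, add_mul, mul_add, mul_add, sandwich_mul, sandwich_mul,
    inclMat_tr_mul_disj p q hpq, inclMat_tr_mul_disj q p (fun a b => (hpq b a).symm)]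
  simp only [Matrix.mul_zero, Matrix.zero_mul, Matrix.mul_one, Matrix.one_mul]
  abel

open Matrix in
lemma embMat_det {F : Type*} [Field F] {n : ℕ} (p : Fin 2 → Fin n)
    (hp : Function.Injective p) (g : Matrix (Fin 2) (Fin 2) F) :
    (embMat p g).det = g.det := by
  unfold embMat
  rw [Matrix.mul_assoc, Matrix.det_one_add_mul_comm, Matrix.mul_assoc, inclMat_tr_mul p hp]
  simp

open Matrix in
lemma tr_embMat_mul {F : Type*} [Field F] {n : ℕ} (p : Fin 2 → Fin n)
    (hp : Function.Injective p) (g : Matrix (Fin 2) (Fin 2) F) :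
    (inclMat F p)ᵀ * embMat p g = g * (inclMat F p)ᵀ := by
  unfold embMat
  rw [Matrix.mul_add, ← Matrix.mul_assoc, ← Matrix.mul_assoc, inclMat_tr_mul p hp]
  simp [Matrix.sub_mul]

open Matrix in
lemma tr_cancel {F : Type*} [Field F] {n : ℕ} (p : Fin 2 → Fin n)
    (hp : Function.Injective p) {g h : Matrix (Fin 2) (Fin 2) F}
    (e : g * (inclMat F p)ᵀ = h * (inclMat F p)ᵀ) : g = h := by
  have := congrArg (· * inclMat F p) e
  simpa [Matrix.mul_assoc, inclMat_tr_mul p hp] using this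

open Matrix in
lemma diag_embMat {F : Type*} [Field F] {n : ℕ} (p : Fin 2 → Fin n)
    (u : Fin n → F) (g g' : Matrix (Fin 2) (Fin 2) F)
    (hg : diagonal (u ∘ p) * g = g' * diagonal (u ∘ p)) :
    diagonal u * embMat p g = embMat p g' * diagonal u := by
  unfold embMat
  rw [Matrix.mul_add, Matrix.add_mul, Matrix.mul_assoc _ _ (diagonal u), inclMat_tr_mul_diag,
    ← Matrix.mul_assoc, ← Matrix.mul_assoc, diag_mul_inclMat, ← Matrix.mul_assoc,
    Matrix.mul_assoc _ (diagonal (u ∘ p)), Matrix.mul_assoc _ _ (diagonal (u ∘ p)),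
    Matrix.mul_sub, Matrix.sub_mul, hg]
  simp

open Matrix in
/-- The root `SL₂` embedding. -/
def embSL {F : Type*} [Field F] {n : ℕ} (p : Fin 2 → Fin n) (hp : Function.Injective p) :
    SpecialLinearGroup (Fin 2) F →* SpecialLinearGroup (Fin n) F where
  toFun g := ⟨embMat p g.1, by rw [embMat_det p hp, g.2]⟩
  map_one' := by
    apply Subtype.ext
    simp [embMat]
  map_mul' g h := by
    apply Subtype.ext
    exact embMat_mul p hp g.1 h.1

open Matrix in
lemma embSL_injective {F : Type*} [Field F] {n : ℕ} (p : Fin 2 → Fin n)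
    (hp : Function.Injective p) : Function.Injective (embSL (F := F) p hp) := by
  intro g h e
  have e1 : embMat p g.1 = embMat p h.1 := congrArg Subtype.val e
  apply Subtype.ext
  apply tr_cancel p hp
  rw [← tr_embMat_mul p hp, e1, tr_embMat_mul p hp]

open Matrix in
lemma embSL_normalized {F : Type*} [Field F] {n : ℕ} (p : Fin 2 → Fin n)
    (hp : Function.Injective p) (t : SpecialLinearGroup (Fin n) F)
    (ht : (t : Matrix (Fin n) (Fin n) F).IsDiag) :
    ∀ k ∈ (embSL (F := F) p hp).range, t * k * t⁻¹ ∈ (embSL (F := F) p hp).range := by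
  rintro _ ⟨g, rfl⟩
  obtain ⟨u, hu⟩ : ∃ u : Fin n → F, t.1 = diagonal u := ⟨_, ht.diagonal_diag.symm⟩
  have hdet : ∏ i, u i = 1 := by
    rw [← Matrix.det_diagonal, ← hu, t.2]
  have hne : ∀ i, u i ≠ 0 := by
    intro i hi
    rw [Finset.prod_eq_zero (Finset.mem_univ i) hi] at hdet
    exact zero_ne_one hdet
  have hinv : diagonal (fun a => (u (p a))⁻¹) * diagonal (u ∘ p) = (1 : Matrix (Fin 2) (Fin 2) F) := by
    rw [Matrix.diagonal_mul_diagonal, ← Matrix.diagonal_one]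
    congr 1
    ext a
    simp [hne]
  let g' : Matrix (Fin 2) (Fin 2) F :=
    diagonal (u ∘ p) * g.1 * diagonal (fun a => (u (p a))⁻¹)
  have hg' : g'.det = 1 := by
    have := congrArg Matrix.det hinv
    rw [Matrix.det_mul, Matrix.det_one] at this
    simp only [g', Matrix.det_mul, g.2, mul_one]
    rw [mul_comm]; exact this
  refine ⟨⟨g', hg'⟩, ?_⟩
  rw [eq_mul_inv_iff_mul_eq]
  apply Subtype.ext
  change embMat p g' * t.1 = t.1 * embMat p g.1
  rw [hu]
  symm
  apply diag_embMat
  simp only [g', Matrix.mul_assoc, hinv, Matrix.mul_one]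

open Matrix in
lemma nonreg_main {F : Type*} [Field F] {n : ℕ}
    (d : Fin n → Fˣ) (s : SpecialLinearGroup (Fin n) F)
    (hs : (s : Matrix (Fin n) (Fin n) F) = Matrix.diagonal (fun i => (d i : F)))
    {i j k l : Fin n} (hij : i ≠ j) (hik : i ≠ k) (hil : i ≠ l) (hjk : j ≠ k) (hjl : j ≠ l)
    (e : d i = d j) (ne : d k ≠ d l) :
    (∃ K Y : Subgroup (Matrix.SpecialLinearGroup (Fin n) F),
      (∀ t : Matrix.SpecialLinearGroup (Fin n) F,
        (t : Matrix (Fin n) (Fin n) F).IsDiag → ∀ k ∈ K, t * k * t⁻¹ ∈ K) ∧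
      (∀ t : Matrix.SpecialLinearGroup (Fin n) F,
        (t : Matrix (Fin n) (Fin n) F).IsDiag → ∀ y ∈ Y, t * y * t⁻¹ ∈ Y) ∧
      (∀ k ∈ K, ∀ y ∈ Y, k * y = y * k) ∧
      (∀ k ∈ K, s * k = k * s) ∧
      (∃ y ∈ Y, s * y ≠ y * s) ∧
      Nonempty (K ≃* Matrix.SpecialLinearGroup (Fin 2) F) ∧
      (Nonempty (Y ≃* Matrix.SpecialLinearGroup (Fin 2) F) ∨
       Nonempty (Y ≃* Matrix.SpecialLinearGroup (Fin (n - 2)) F))) := by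
  have hkl : k ≠ l := fun h => ne (by rw [h])
  have hp : Function.Injective ![i, j] := by
    intro a b; fin_cases a <;> fin_cases b <;> simp [hij, hij.symm]
  have hq : Function.Injective ![k, l] := by
    intro a b; fin_cases a <;> fin_cases b <;> simp [hkl, hkl.symm]
  have hpq : ∀ a b, (![i, j] : Fin 2 → Fin n) a ≠ (![k, l] : Fin 2 → Fin n) b := by
    intro a b; fin_cases a <;> fin_cases b <;> simp [*]
  refine ⟨(embSL (F := F) _ hp).range, (embSL (F := F) _ hq).range, embSL_normalized _ hp,
    embSL_normalized _ hq, ?_, ?_, ?_, ⟨(MonoidHom.ofInjective (embSL_injective _ hp)).symm⟩,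
    Or.inl ⟨(MonoidHom.ofInjective (embSL_injective _ hq)).symm⟩⟩
  · rintro _ ⟨g, rfl⟩ _ ⟨h, rfl⟩
    apply Subtype.ext
    exact embMat_comm _ _ hpq g.1 h.1
  · rintro _ ⟨g, rfl⟩
    apply Subtype.ext
    change s.1 * embMat _ g.1 = embMat _ g.1 * s.1
    rw [hs]
    apply diag_embMat
    ext a b
    fin_cases a <;> fin_cases b <;> simp [e, mul_comm]
  · refine ⟨_, ⟨⟨!![1, 1; 0, 1], by simp [Matrix.det_fin_two]⟩, rfl⟩, ?_⟩
    intro h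
    have h1 : s.1 * embMat ![k, l] !![1, 1; 0, 1] = embMat ![k, l] !![1, 1; 0, 1] * s.1 :=
      congrArg Subtype.val h
    rw [hs] at h1
    have h2 := congrArg (fun M => (inclMat F ![k, l])ᵀ * M) h1
    simp only [← Matrix.mul_assoc] at h2
    rw [tr_embMat_mul _ hq, inclMat_tr_mul_diag, Matrix.mul_assoc, tr_embMat_mul _ hq,
      Matrix.mul_assoc, inclMat_tr_mul_diag, ← Matrix.mul_assoc, ← Matrix.mul_assoc] at h2
    have h3 := congrFun (congrFun (tr_cancel _ hq h2) 0) 1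
    simp at h3
    exact ne (Units.ext h3)

/-- **Lemma 4.1.** Let `s = diag(d₁, …, d_n) ∈ SL_n(F)`, `n > 3`, be non-central and
non-regular. Then either `n = 4` and the diagonal of `s` is `(a, a, a⁻¹, a⁻¹)` or
`(a, a, -a⁻¹, -a⁻¹)` up to conjugacy (i.e. as a multiset), or there are subgroups
`K ≅ SL₂(F)` and `Y ≅ SL₂(F)` or `SL_{n-2}(F)`, normalized by the diagonal torus,
commuting with each other, with `[K, s] = 1` and `[Y, s] ≠ 1`. -/
theorem SLn_nonregular_commuting_subsystem_subgroups
    {F : Type*} [Field F] [IsAlgClosed F] {n : ℕ} (hn : 3 < n)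
    (d : Fin n → Fˣ) (s : Matrix.SpecialLinearGroup (Fin n) F)
    (hs : (s : Matrix (Fin n) (Fin n) F) = Matrix.diagonal (fun i => (d i : F)))
    (hnoncentral : ¬ ∀ i j, d i = d j)
    (hnonregular : ∃ i j, i ≠ j ∧ d i = d j) :
    (n = 4 ∧ ∃ a : Fˣ,
        Multiset.map d Finset.univ.val = {a, a, a⁻¹, a⁻¹} ∨
        Multiset.map d Finset.univ.val = {a, a, -a⁻¹, -a⁻¹}) ∨
    (∃ K Y : Subgroup (Matrix.SpecialLinearGroup (Fin n) F),
      (∀ t : Matrix.SpecialLinearGroup (Fin n) F,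
        (t : Matrix (Fin n) (Fin n) F).IsDiag → ∀ k ∈ K, t * k * t⁻¹ ∈ K) ∧
      (∀ t : Matrix.SpecialLinearGroup (Fin n) F,
        (t : Matrix (Fin n) (Fin n) F).IsDiag → ∀ y ∈ Y, t * y * t⁻¹ ∈ Y) ∧
      (∀ k ∈ K, ∀ y ∈ Y, k * y = y * k) ∧
      (∀ k ∈ K, s * k = k * s) ∧
      (∃ y ∈ Y, s * y ≠ y * s) ∧
      Nonempty (K ≃* Matrix.SpecialLinearGroup (Fin 2) F) ∧
      (Nonempty (Y ≃* Matrix.SpecialLinearGroup (Fin 2) F) ∨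
       Nonempty (Y ≃* Matrix.SpecialLinearGroup (Fin (n - 2)) F))) := by
  classical
  obtain ⟨i, j, hij, e⟩ := hnonregular
  by_cases H : ∃ k l, k ≠ i ∧ k ≠ j ∧ l ≠ i ∧ l ≠ j ∧ d k ≠ d l
  · obtain ⟨k, l, h1, h2, h3, h4, h5⟩ := H
    exact Or.inr (nonreg_main d s hs hij h1.symm h3.symm h2.symm h4.symm e h5)
  push Not at H
  have hcard : 1 < (({i, j} : Finset (Fin n))ᶜ).card := by
    rw [Finset.card_compl, Finset.card_pair hij, Fintype.card_fin]; omega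
  obtain ⟨k, hk, l, hl, hkl⟩ := Finset.one_lt_card.1 hcard
  simp only [Finset.mem_compl, Finset.mem_insert, Finset.mem_singleton, not_or] at hk hl
  have ekl : d k = d l := H k l hk.1 hk.2 hl.1 hl.2
  have hik : d i ≠ d k := by
    intro hik
    apply hnoncentral
    have : ∀ x, d x = d k := by
      intro x
      by_cases hxi : x = i
      · rw [hxi, hik]
      by_cases hxj : x = j
      · rw [hxj, ← e, hik]
      exact H x k hxi hxj hk.1 hk.2
    intro x y
    rw [this x, this y]
  by_cases hn4 : n = 4
  · left
    refine ⟨hn4, d i, ?_⟩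
    have hv : (Finset.univ : Finset (Fin n)).val = {i, j, k, l} := by
      symm
      apply Multiset.eq_of_le_of_card_le
      · rw [Multiset.le_iff_subset]
        · intro x _
          exact Finset.mem_univ x
        · simp [hij, Ne.symm hk.1, Ne.symm hk.2, Ne.symm hl.1, Ne.symm hl.2, hkl]
      · simp [hn4]
    have hdet : ∏ x, (d x : F) = 1 := by
      rw [← Matrix.det_diagonal, ← hs, s.2]
    have hprod : (d i : F) * (d k) = 1 ∨ (d i : F) * (d k) = -1 := by
      rw [Finset.prod_eq_multiset_prod, hv] at hdet
      simp [← e, ← ekl] at hdet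
      rw [← sq_eq_one_iff]
      linear_combination hdet
    rw [hv]
    rcases hprod with h | h
    · left
      have : d k = (d i)⁻¹ := by
        rw [eq_inv_iff_mul_eq_one, mul_comm]; ext; simpa using h
      simp [← e, ← ekl, this]
    · right
      have : d k = -(d i)⁻¹ := by
        rw [eq_comm, neg_eq_iff_eq_neg, inv_eq_iff_mul_eq_one]; ext; simp [h]
      simp [← e, ← ekl, this]
  · right
    have hcard : 0 < (({i, j, k, l} : Finset (Fin n))ᶜ).card := by
      have := Finset.card_le_four (a := i) (b := j) (c := k) (d := l)
      rw [Finset.card_compl, Fintype.card_fin]; omega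
    obtain ⟨m, hm⟩ := Finset.card_pos.1 hcard
    simp only [Finset.mem_compl, Finset.mem_insert, Finset.mem_singleton, not_or] at hm
    refine nonreg_main d s hs (i := k) (j := l) (k := i) (l := m) hkl hk.1 (Ne.symm hm.2.2.1)
      hl.1 (Ne.symm hm.2.2.2) ekl ?_
    rw [H m k hm.1 hm.2.1 hk.1 hk.2]
    exact hik
end

section
/- In type D_n (n ≥ 5), where the simple roots are α_i = −ω_{i−1} + 2ω_i − ω_{i+1} for 1 ≤ i ≤ n−3, α_{n−2} = −ω_{n−3} + 2ω_{n−2} − ω_{n−1} − ω_n, α_{n−1} = −ω_{n−2} + 2ω_{n−1}, and α_n = −ω_{n−2} + 2ω_n, the level sets satisfy: Λ₁ = {0, ω_1, ω_{n−1}, ω_n} and Λ₂ = {ω_2, ω_3, ω_1 + ω_{n−1}, ω_1 + ω_n}. -/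
namespace WeightLevelsDn

/-- The simple roots of `D_n` written in the basis of fundamental dominant weights:
`α_i = -ω_{i-1} + 2ω_i - ω_{i+1}` for `i ≤ n-3`,
`α_{n-2} = -ω_{n-3} + 2ω_{n-2} - ω_{n-1} - ω_n`, `α_{n-1} = -ω_{n-2} + 2ω_{n-1}` and
`α_n = -ω_{n-2} + 2ω_n`, with `0`-based indexing. -/
def alpha (n : ℕ) (i : Fin n) : Fin n → ℤ := fun j =>
  if (i : ℕ) < n - 3 then
    (if j = i then 2
     else if (j : ℕ) + 1 = (i : ℕ) ∨ (i : ℕ) + 1 = (j : ℕ) then -1 else 0)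
  else if (i : ℕ) = n - 3 then
    (if j = i then 2
     else if (j : ℕ) + 1 = (i : ℕ) ∨ (i : ℕ) + 1 = (j : ℕ) ∨ (i : ℕ) + 2 = (j : ℕ)
       then -1 else 0)
  else
    (if j = i then 2 else if (j : ℕ) = n - 3 then -1 else 0)

/-- A weight is dominant if all its coordinates (in the fundamental weight basis) are `≥ 0`. -/
def dominant (n : ℕ) (l : Fin n → ℤ) : Prop := ∀ i, 0 ≤ l i

/-- `prec n μ λ` means `μ ≺ λ`: `μ ≠ λ` and `λ - μ` is an `ℕ`-linear combination of the
simple roots. -/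
def prec (n : ℕ) (μ l : Fin n → ℤ) : Prop :=
  μ ≠ l ∧ ∃ c : Fin n → ℕ, l = μ + ∑ i, (c i : ℤ) • alpha n i

/-- `cum n i` is the union `Λ₁ ∪ ⋯ ∪ Λ_i` of the first `i` level sets. -/
def cum (n : ℕ) : ℕ → Set (Fin n → ℤ)
  | 0 => ∅
  | i + 1 => cum n i ∪
      {l | dominant n l ∧ l ∉ cum n i ∧ ∀ ν, dominant n ν → prec n ν l → ν ∈ cum n i}

/-- `level n i` is the set `Λ_i` of weights of level `i` (for `i ≥ 1`). -/
def level (n : ℕ) (i : ℕ) : Set (Fin n → ℤ) :=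
  {l | dominant n l ∧ l ∉ cum n (i - 1) ∧ ∀ ν, dominant n ν → prec n ν l → ν ∈ cum n (i - 1)}


/-- Extension of a weight by zero to all natural indices. -/
def X (m : ℕ) (l : Fin (m + 3) → ℤ) (j : ℕ) : ℤ := if h : j < m + 3 then l ⟨j, h⟩ else 0

/-- Coordinates of `∑ C i • α i`. -/
def D (m : ℕ) (C : ℕ → ℕ) (j : ℕ) : ℤ :=
  if j < m then 2 * (C j : ℤ) - (if j = 0 then 0 else (C (j - 1) : ℤ)) - C (j + 1)
  else if j = m then 2 * (C m : ℤ) - C (m - 1) - C (m + 1) - C (m + 2)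
  else 2 * (C j : ℤ) - C m

lemma sum_ind (n k : ℕ) (hk : k < n) (a : ℤ) :
    ∑ i : Fin n, (if (i : ℕ) = k then a else 0) = a := by
  rw [Fin.sum_univ_eq_sum_range (fun i => if i = k then a else 0) n]
  simp [hk]

lemma alpha_sum (m : ℕ) (hm : 2 ≤ m) (C : ℕ → ℕ) (j : Fin (m + 3)) :
    (∑ i : Fin (m + 3), (C i : ℤ) • alpha (m + 3) i) j = D m C j := by
  rw [Finset.sum_apply]
  obtain ⟨j, hj⟩ := j
  simp only [Pi.smul_apply, smul_eq_mul]
  unfold D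
  by_cases h1 : j < m
  · by_cases h0 : j = 0
    · subst h0
      have : ∀ i : Fin (m + 3), (C i : ℤ) * alpha (m + 3) i ⟨0, hj⟩ =
          (if (i : ℕ) = 0 then 2 * (C 0 : ℤ) else 0) +
          (if (i : ℕ) = 1 then -(C 1 : ℤ) else 0) := by
        rintro ⟨i, hi⟩
        simp only [alpha, Fin.mk.injEq]
        split_ifs <;> first | omega | grind | (subst_vars; simp; done) | (subst_vars; ring)
      rw [Finset.sum_congr rfl (fun i _ => this i), Finset.sum_add_distrib,
        sum_ind _ _ (by omega), sum_ind _ _ (by omega)]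
      simp [h1]; ring
    · have : ∀ i : Fin (m + 3), (C i : ℤ) * alpha (m + 3) i ⟨j, hj⟩ =
          (if (i : ℕ) = j then 2 * (C j : ℤ) else 0) +
          (if (i : ℕ) = j - 1 then -(C (j - 1) : ℤ) else 0) +
          (if (i : ℕ) = j + 1 then -(C (j + 1) : ℤ) else 0) := by
        rintro ⟨i, hi⟩
        simp only [alpha, Fin.mk.injEq]
        split_ifs <;> first | omega | (subst_vars; simp; done) | (subst_vars; ring)
      rw [Finset.sum_congr rfl (fun i _ => this i), Finset.sum_add_distrib,
        Finset.sum_add_distrib,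
        sum_ind _ _ (by omega), sum_ind _ _ (by omega), sum_ind _ _ (by omega)]
      simp [h1, h0]; ring
  · by_cases h2 : j = m
    · subst h2
      have : ∀ i : Fin (j + 3), (C i : ℤ) * alpha (j + 3) i ⟨j, hj⟩ =
          (if (i : ℕ) = j then 2 * (C j : ℤ) else 0) +
          (if (i : ℕ) = j - 1 then -(C (j - 1) : ℤ) else 0) +
          (if (i : ℕ) = j + 1 then -(C (j + 1) : ℤ) else 0) +
          (if (i : ℕ) = j + 2 then -(C (j + 2) : ℤ) else 0) := by
        rintro ⟨i, hi⟩
        simp only [alpha, Fin.mk.injEq]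
        split_ifs <;> first | omega | (subst_vars; simp; done) | (subst_vars; ring)
      rw [Finset.sum_congr rfl (fun i _ => this i), Finset.sum_add_distrib,
        Finset.sum_add_distrib, Finset.sum_add_distrib,
        sum_ind _ _ (by omega), sum_ind _ _ (by omega), sum_ind _ _ (by omega),
        sum_ind _ _ (by omega)]
      simp; ring
    · have : ∀ i : Fin (m + 3), (C i : ℤ) * alpha (m + 3) i ⟨j, hj⟩ =
          (if (i : ℕ) = j then 2 * (C j : ℤ) else 0) +
          (if (i : ℕ) = m then -(C m : ℤ) else 0) := by
        rintro ⟨i, hi⟩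
        simp only [alpha, Fin.mk.injEq]
        split_ifs <;> first | omega | (subst_vars; simp; done) | (subst_vars; ring)
      rw [Finset.sum_congr rfl (fun i _ => this i), Finset.sum_add_distrib,
        sum_ind _ _ (by omega), sum_ind _ _ (by omega)]
      simp [h1, h2]; ring

lemma X_ext (m : ℕ) (l l' : Fin (m + 3) → ℤ) :
    l = l' ↔ ∀ j < m + 3, X m l j = X m l' j := by
  constructor
  · rintro rfl j _; rfl
  · intro h
    ext ⟨j, hj⟩
    simpa [X, hj] using h j hj

lemma X_single (m k : ℕ) (hk : k < m + 3) (j : ℕ) :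
    X m (Pi.single (⟨k, hk⟩ : Fin (m + 3)) (1 : ℤ)) j = if j = k then 1 else 0 := by
  unfold X
  split_ifs with h1 h2 h2
  · subst h2; simp
  · simp [Pi.single_apply, h2]
  · omega
  · rfl

lemma X_add (m : ℕ) (l l' : Fin (m + 3) → ℤ) (j : ℕ) :
    X m (l + l') j = X m l j + X m l' j := by
  unfold X; split_ifs <;> simp

lemma X_zero (m : ℕ) (j : ℕ) : X m 0 j = 0 := by
  unfold X; split_ifs <;> simp

lemma dom_iff (m : ℕ) (l : Fin (m + 3) → ℤ) :
    dominant (m + 3) l ↔ ∀ j, 0 ≤ X m l j := by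
  constructor
  · intro h j
    unfold X
    split_ifs with hj
    · exact h _
    · exact le_rfl
  · rintro h ⟨j, hj⟩
    simpa [X, hj] using h j

lemma prec_data (m : ℕ) (hm : 2 ≤ m) (v l : Fin (m + 3) → ℤ) (h : prec (m + 3) v l) :
    ∃ C : ℕ → ℕ, (∀ j < m + 3, X m l j = X m v j + D m C j) ∧ ¬ (∀ j < m + 3, C j = 0) := by
  obtain ⟨hne, c, hc⟩ := h
  let C : ℕ → ℕ := fun j => if h : j < m + 3 then c ⟨j, h⟩ else 0
  have hC : ∀ i : Fin (m + 3), c i = C i := by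
    intro i; simp [C]
  refine ⟨C, ?_, ?_⟩
  · intro j hj
    have h1 := alpha_sum m hm C ⟨j, hj⟩
    simp only [← hC] at h1
    have := congrFun hc ⟨j, hj⟩
    rw [Pi.add_apply, h1] at this
    simpa [X, hj] using this
  · intro h0
    apply hne
    rw [hc]
    have : ∀ i, c i = 0 := fun i => by rw [hC]; exact h0 _ i.2
    simp [this]

lemma move (m : ℕ) (hm : 2 ≤ m) (l : Fin (m + 3) → ℤ) (C : ℕ → ℕ) (k : ℕ) (hk : k < m + 3)
    (hk' : D m C k ≠ 0)
    (h : ∀ j < m + 3, D m C j ≤ X m l j) :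
    ∃ v, dominant (m + 3) v ∧ prec (m + 3) v l ∧ ∀ j < m + 3, X m v j = X m l j - D m C j := by
  have key : ∀ j < m + 3, X m (l - ∑ i : Fin (m + 3), (C i : ℤ) • alpha (m + 3) i) j
      = X m l j - D m C j := by
    intro j hj
    simp only [X, hj, dif_pos, Pi.sub_apply, alpha_sum m hm C ⟨j, hj⟩]
  refine ⟨l - ∑ i : Fin (m + 3), (C i : ℤ) • alpha (m + 3) i, ?_, ⟨?_, fun i => C i, ?_⟩, key⟩
  · rw [dom_iff]
    intro j
    by_cases hj : j < m + 3
    · rw [key j hj]; linarith [h j hj]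
    · simp [X, hj]
  · intro he
    have := (X_ext m _ _).1 he k hk
    rw [key k hk] at this
    omega
  · simp

/-- Differences of the coefficient sequence. -/
def dd (m : ℕ) (C : ℕ → ℕ) (j : ℕ) : ℤ :=
  if j ≤ m then (C j : ℤ) - C (j - 1) else C (m + 1) + C (m + 2) - C m

lemma dd_step (m : ℕ) (C : ℕ → ℕ) (j : ℕ) (h1 : 1 ≤ j) (h2 : j ≤ m) :
    dd m C (j + 1) = dd m C j - D m C j := by
  unfold dd D
  rcases Nat.lt_or_ge j m with h | h
  · have h0 : j ≠ 0 := by omega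
    have h3 : j + 1 ≤ m := h
    simp [h, h0, h3, h2]; ring
  · have : j = m := by omega
    subst this
    simp; ring

lemma tail (m k : ℕ) (C : ℕ → ℕ) (V L : ℕ → ℤ) (hk : 1 ≤ k) (hkm : k ≤ m + 1)
    (hV : ∀ j, 0 ≤ V j) (h : ∀ j < m + 3, L j = V j + D m C j)
    (hL : ∀ j, k ≤ j → j ≤ m → L j = 0) (hs : L (m + 1) + L (m + 2) ≤ 1) :
    dd m C k ≤ 0 ∧
    (C (k - 1) = 0 → ∀ j, k - 1 ≤ j → j < m + 3 → C j = 0) ∧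
    (dd m C k = 0 → (∀ j, k ≤ j → j ≤ m → V j = 0) ∧
      V (m + 1) + V (m + 2) = L (m + 1) + L (m + 2) ∧
      C (m + 1) + C (m + 2) = C (k - 1) ∧
      (C (m + 2) : ℤ) - C (m + 1) = L (m + 2) - V (m + 2)) := by
  have e1 : L (m + 1) = V (m + 1) + (2 * (C (m + 1) : ℤ) - C m) := by
    have := h (m + 1) (by omega)
    simpa [D] using this
  have e2 : L (m + 2) = V (m + 2) + (2 * (C (m + 2) : ℤ) - C m) := by
    have := h (m + 2) (by omega)
    simpa [D] using this
  have hE : dd m C (m + 1) = C (m + 1) + C (m + 2) - C m := by simp [dd]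
  have step : ∀ j, k ≤ j → j ≤ m → dd m C (j + 1) = dd m C j + V j := by
    intro j h1 h2
    rw [dd_step m C j (by omega) h2]
    have := h j (by omega)
    have := hL j h1 h2
    omega
  have le0 : ∀ t j, j + t = m + 1 → k ≤ j → dd m C j ≤ 0 := by
    intro t
    induction t with
    | zero =>
      intro j hj _
      have hj' : j = m + 1 := by omega
      subst hj'
      have := hV (m + 1)
      have := hV (m + 2)
      omega
    | succ t ih =>
      intro j hj hkj
      have := ih (j + 1) (by omega) (by omega)
      have := step j hkj (by omega)
      have := hV j
      omega
  have le1 : ∀ j, k ≤ j → j ≤ m + 1 → dd m C j ≤ 0 := fun j a b => le0 (m + 1 - j) j (by omega) a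
  refine ⟨le1 k le_rfl hkm, ?_, ?_⟩
  · intro hC0
    have hz : ∀ j, k - 1 ≤ j → j ≤ m → C j = 0 := by
      intro j hj
      induction j, hj using Nat.le_induction with
      | base => intro _; exact hC0
      | succ j hj ih =>
        intro hjm
        have a := ih (by omega)
        have b := le1 (j + 1) (by omega) (by omega)
        simp only [dd, hjm, if_true, Nat.add_sub_cancel] at b
        omega
    intro j hj1 hj2
    rcases Nat.lt_or_ge m j with hj | hj
    · have a := hz m (by omega) le_rfl
      have b := le1 (m + 1) (by omega) le_rfl
      have : j = m + 1 ∨ j = m + 2 := by omega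
      rcases this with rfl | rfl <;> omega
    · exact hz j hj1 hj
  · intro hd0
    have hd : ∀ j, k ≤ j → j ≤ m + 1 → dd m C j = 0 := by
      intro j hj
      induction j, hj using Nat.le_induction with
      | base => intro _; exact hd0
      | succ j hj ih =>
        intro hjm
        have a := ih (by omega)
        have b := le1 (j + 1) (by omega) (by omega)
        have := step j hj (by omega)
        have := hV j
        omega
    have hc : ∀ j, k - 1 ≤ j → j ≤ m → C j = C (k - 1) := by
      intro j hj
      induction j, hj using Nat.le_induction with
      | base => intro _; rfl
      | succ j hj ih =>
        intro hjm
        have a := ih (by omega)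
        have b := hd (j + 1) (by omega) (by omega)
        simp only [dd, hjm, if_true, Nat.add_sub_cancel] at b
        omega
    have a := hd (m + 1) hkm le_rfl
    have b := hc m (by omega) le_rfl
    refine ⟨?_, by omega, by omega, by omega⟩
    intro j h1 h2
    have := step j h1 h2
    have := hd j h1 (by omega)
    have := hd (j + 1) (by omega) (by omega)
    omega

/-- The claimed first level. -/
def P1 (m : ℕ) (V : ℕ → ℤ) : Prop :=
  (∀ j < m + 3, V j = 0) ∨ (∀ j < m + 3, V j = if j = 0 then 1 else 0) ∨
  (∀ j < m + 3, V j = if j = m + 1 then 1 else 0) ∨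
  (∀ j < m + 3, V j = if j = m + 2 then 1 else 0)

/-- The claimed second level. -/
def P2 (m : ℕ) (V : ℕ → ℤ) : Prop :=
  (∀ j < m + 3, V j = if j = 1 then 1 else 0) ∨ (∀ j < m + 3, V j = if j = 2 then 1 else 0) ∨
  (∀ j < m + 3, V j = (if j = 0 then 1 else 0) + if j = m + 1 then 1 else 0) ∨
  (∀ j < m + 3, V j = (if j = 0 then 1 else 0) + if j = m + 2 then 1 else 0)

lemma seq0 (m : ℕ) (hm : 2 ≤ m) (C : ℕ → ℕ) (V L : ℕ → ℤ)
    (h : ∀ j < m + 3, L j = V j + D m C j) :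
    dd m C 1 = C 0 + V 0 - L 0 ∧ dd m C 2 = dd m C 1 + V 1 - L 1 ∧
    dd m C 3 = dd m C 2 + V 2 - L 2 ∧ dd m C 1 = C 1 - C 0 ∧ dd m C 2 = C 2 - C 1 := by
  have h1 := dd_step m C 1 le_rfl (by omega)
  have h2 := dd_step m C 2 (by omega) hm
  have a0 := h 0 (by omega)
  have a1 := h 1 (by omega)
  have a2 := h 2 (by omega)
  have b1 : dd m C 1 = C 1 - C 0 := by
    have : 1 ≤ m := by omega
    simp [dd, this]
  have b2 : dd m C 2 = C 2 - C 1 := by simp [dd, hm]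
  have b0 : D m C 0 = 2 * C 0 - C 1 := by
    have : 0 < m := by omega
    simp [D, this]
  norm_num at h1 h2
  refine ⟨by omega, by omega, by omega, b1, b2⟩

lemma low1 (m : ℕ) (hm : 2 ≤ m) (C : ℕ → ℕ) (V L : ℕ → ℤ)
    (hV : ∀ j, 0 ≤ V j) (h : ∀ j < m + 3, L j = V j + D m C j)
    (hC : ¬ (∀ j < m + 3, C j = 0)) (hL : P1 m L) : False := by
  obtain ⟨s1, s2, s3, s4, s5⟩ := seq0 m hm C V L h
  have v0 := hV 0
  have v1 := hV (m + 1)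
  have v2 := hV (m + 2)
  have hz : ∀ j, 1 ≤ j → j ≤ m → L j = 0 := by
    intro j h1 h2
    rcases hL with hL | hL | hL | hL <;> rw [hL j (by omega)] <;> split_ifs <;> omega
  have hvals : (L 0 = 0 ∧ L (m + 1) + L (m + 2) ≤ 1) ∨
      (L 0 = 1 ∧ L (m + 1) = 0 ∧ L (m + 2) = 0) := by
    rcases hL with hL | hL | hL | hL <;>
      rw [hL 0 (by omega), hL (m + 1) (by omega), hL (m + 2) (by omega)] <;> simp
  obtain ⟨t1, t2, t3⟩ := tail m 1 C V L le_rfl (by omega) hV h hz (by omega)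
  have hc0 : C 0 ≠ 0 := fun h0 => hC fun j hj => t2 h0 j (by omega) hj
  have hd : dd m C 1 = 0 := by omega
  obtain ⟨u1, u2, u3, u4⟩ := t3 hd
  simp only [Nat.sub_self] at u3
  omega

lemma low2 (m : ℕ) (hm : 2 ≤ m) (C : ℕ → ℕ) (V L : ℕ → ℤ)
    (hV : ∀ j, 0 ≤ V j) (h : ∀ j < m + 3, L j = V j + D m C j)
    (hC : ¬ (∀ j < m + 3, C j = 0)) (hL : P2 m L) : P1 m V := by
  obtain ⟨s1, s2, s3, s4, s5⟩ := seq0 m hm C V L h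
  have v0 := hV 0
  have w1 := hV 1
  have w2 := hV 2
  have v1 := hV (m + 1)
  have v2 := hV (m + 2)
  have hz : ∀ j, 3 ≤ j → j ≤ m → L j = 0 := by
    intro j h1 h2
    rcases hL with hL | hL | hL | hL <;> rw [hL j (by omega)] <;> split_ifs <;> omega
  have fin : (∀ j, 3 ≤ j → j ≤ m → V j = 0) → V 1 = 0 → V 2 = 0 →
      V 0 + V (m + 1) + V (m + 2) ≤ 1 → P1 m V := by
    intro f1 f2 f3 f4
    have hall : ∀ j < m + 3, j = 0 ∨ j = m + 1 ∨ j = m + 2 ∨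
        (j ≠ 0 ∧ j ≠ m + 1 ∧ j ≠ m + 2 ∧ V j = 0) := by
      intro j hj
      by_cases j1 : j = 1
      · subst j1; omega
      by_cases j2 : j = 2
      · subst j2; omega
      by_cases j3 : 3 ≤ j ∧ j ≤ m
      · have := f1 j j3.1 j3.2; omega
      omega
    clear s1 s2 s3 s4 s5 hL hz h hC
    have : (V 0 = 0 ∧ V (m + 1) = 0 ∧ V (m + 2) = 0) ∨ (V 0 = 1 ∧ V (m + 1) = 0 ∧ V (m + 2) = 0) ∨
       (V 0 = 0 ∧ V (m + 1) = 1 ∧ V (m + 2) = 0) ∨ (V 0 = 0 ∧ V (m + 1) = 0 ∧ V (m + 2) = 1) := by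
      omega
    rcases this with g | g | g | g
    · left
      intro j hj
      rcases hall j hj with rfl | rfl | rfl | g' <;> omega
    · right; left
      intro j hj
      rcases hall j hj with rfl | rfl | rfl | g' <;> grind
    · right; right; left
      intro j hj
      rcases hall j hj with rfl | rfl | rfl | g' <;> grind
    · right; right; right
      intro j hj
      rcases hall j hj with rfl | rfl | rfl | g' <;> grind
  have hvals : (L 0 = 0 ∧ L 1 = 1 ∧ L 2 = 0 ∧ L (m + 1) = 0 ∧ L (m + 2) = 0) ∨
      (L 0 = 0 ∧ L 1 = 0 ∧ L 2 = 1 ∧ L (m + 1) = 0 ∧ L (m + 2) = 0) ∨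
      (L 0 = 1 ∧ L 1 = 0 ∧ L 2 = 0 ∧ L (m + 1) + L (m + 2) = 1) := by
    have q1 : ¬ (1 = m + 1) := by omega
    have q2 : ¬ (2 = m + 1) := by omega
    have q3 : ¬ (m = 0) := by omega
    have q4 : ¬ (m = 1) := by omega
    rcases hL with hL | hL | hL | hL <;>
      rw [hL 0 (by omega), hL 1 (by omega), hL 2 (by omega), hL (m + 1) (by omega),
        hL (m + 2) (by omega)] <;> simp [q1, q2, q3, q4]
  rcases hvals with g | g | g
  · obtain ⟨t1, t2, t3⟩ := tail m 2 C V L (by omega) (by omega) hV h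
      (by
        intro j h1 h2
        by_cases j2 : j = 2
        · subst j2; omega
        · exact hz j (by omega) h2) (by omega)
    norm_num at t2 t3
    have hc0 : ¬ (C 0 = 0 ∧ C 1 = 0) := fun h0 => hC fun j hj => by
      by_cases j0 : j = 0
      · subst j0; exact h0.1
      · exact t2 h0.2 j (by omega) hj
    have hd : dd m C 2 = 0 := by omega
    obtain ⟨u1, u2, u3, u4⟩ := t3 hd
    have := u1 2 le_rfl hm
    exact fin (fun j a b => u1 j (by omega) b) (by omega) (by omega) (by omega)
  · obtain ⟨t1, t2, t3⟩ := tail m 3 C V L (by omega) (by omega) hV h hz (by omega)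
    norm_num at t2 t3
    have hc0 : ¬ (C 0 = 0 ∧ C 1 = 0 ∧ C 2 = 0) := fun h0 => hC fun j hj => by
      by_cases j0 : j = 0
      · subst j0; exact h0.1
      by_cases j1 : j = 1
      · subst j1; exact h0.2.1
      · exact t2 h0.2.2 j (by omega) hj
    have hd : dd m C 3 = 0 := by omega
    obtain ⟨u1, u2, u3, u4⟩ := t3 hd
    exact fin u1 (by omega) (by omega) (by omega)
  · obtain ⟨t1, t2, t3⟩ := tail m 1 C V L (by omega) (by omega) hV h
      (by
        intro j h1 h2
        by_cases j1 : j = 1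
        · subst j1; omega
        by_cases j2 : j = 2
        · subst j2; omega
        · exact hz j (by omega) h2) (by omega)
    norm_num at t2 t3
    have hc0 : C 0 ≠ 0 := fun h0 => hC fun j hj => t2 h0 j hj
    have hd : dd m C 1 = 0 := by omega
    obtain ⟨u1, u2, u3, u4⟩ := t3 hd
    have := u1 1 le_rfl (by omega)
    have := u1 2 (by omega) hm
    exact fin (fun j a b => u1 j (by omega) b) (by omega) (by omega) (by omega)

lemma not_P1 (m : ℕ) (V : ℕ → ℤ) (k : ℕ) (h1 : 1 ≤ k) (h2 : k ≤ m) (h : 1 ≤ V k) : ¬ P1 m V := by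
  rintro (g | g | g | g) <;> have g' := g k (by omega) <;> grind

lemma mv (m : ℕ) (hm : 2 ≤ m) (l : Fin (m + 3) → ℤ) (C : ℕ → ℕ) (T : ℕ → ℤ) (k : ℕ)
    (hk : k < m + 3) (hk' : T k ≠ 0)
    (t0 : T 0 = 2 * (C 0 : ℤ) - C 1)
    (t1 : ∀ j, j + 1 < m → T (j + 1) = 2 * (C (j + 1) : ℤ) - C j - C (j + 2))
    (t2 : T m = 2 * (C m : ℤ) - C (m - 1) - C (m + 1) - C (m + 2))
    (t3 : T (m + 1) = 2 * (C (m + 1) : ℤ) - C m)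
    (t4 : T (m + 2) = 2 * (C (m + 2) : ℤ) - C m)
    (h : ∀ j < m + 3, T j ≤ X m l j) :
    ∃ v, dominant (m + 3) v ∧ prec (m + 3) v l ∧ ∀ j < m + 3, X m v j = X m l j - T j := by
  have key : ∀ j < m + 3, D m C j = T j := by
    intro j hj
    unfold D
    by_cases h1 : j < m
    · rcases j with _ | j
      · simp [h1, t0]
      · simp [h1, t1 j h1]
    · have : j = m ∨ j = m + 1 ∨ j = m + 2 := by omega
      rcases this with rfl | rfl | rfl
      · simp [t2]
      · simp [t3]
      · simp [t4]
  obtain ⟨v, a, b, c⟩ := move m hm l C k hk (by rwa [key k hk])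
    (fun j hj => by rw [key j hj]; exact h j hj)
  exact ⟨v, a, b, fun j hj => by rw [c j hj, key j hj]⟩

/-- Move `ω_i → ω_{i-2}` -/
lemma M1 (m : ℕ) (hm : 2 ≤ m) (l : Fin (m + 3) → ℤ) (hd : ∀ j, 0 ≤ X m l j)
    (i : ℕ) (hi1 : 1 ≤ i) (hi2 : i ≤ m) (hi : 1 ≤ X m l i) :
    ∃ v, dominant (m + 3) v ∧ prec (m + 3) v l ∧
      ∀ j < m + 3, X m v j = X m l j -
        ((if j = i then 1 else 0) - (if j + 2 = i then 1 else 0)) := by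
  obtain ⟨C, hC⟩ : ∃ C : ℕ → ℕ, ∀ j, (j + 1 < i → C j = 0) ∧ (j + 1 = i → C j = 1) ∧
      (i ≤ j → j ≤ m → C j = 2) ∧ (m < j → C j = 1) :=
    ⟨fun j => if j + 1 < i then 0 else if j + 1 = i then 1 else if j ≤ m then 2 else 1, by grind⟩
  refine mv m hm l C (fun j => (if j = i then 1 else 0) - (if j + 2 = i then 1 else 0)) i
    (by omega) ?_ ?_ ?_ ?_ ?_ ?_ ?_
  · simp
  · have := hC 0; have := hC 1; grind
  · intro j hj; have := hC j; have := hC (j + 1); have := hC (j + 2); grind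
  · have := hC m; have := hC (m - 1); have := hC (m + 1); have := hC (m + 2); grind
  · have := hC m; have := hC (m + 1); grind
  · have := hC m; have := hC (m + 2); grind
  · intro j hj; have := hd j; grind

/-- Move `ω_0 + ω_1 → ω_2` -/
lemma M2 (m : ℕ) (hm : 2 ≤ m) (l : Fin (m + 3) → ℤ) (hd : ∀ j, 0 ≤ X m l j)
    (h0 : 1 ≤ X m l 0) (h1 : 1 ≤ X m l 1) :
    ∃ v, dominant (m + 3) v ∧ prec (m + 3) v l ∧ ¬ P1 m (X m v) := by
  obtain ⟨C, hC⟩ : ∃ C : ℕ → ℕ, ∀ j, (j ≤ 1 → C j = 1) ∧ (1 < j → C j = 0) :=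
    ⟨fun j => if j ≤ 1 then 1 else 0, by grind⟩
  obtain ⟨v, a, b, c⟩ := mv m hm l C (fun j => if j ≤ 1 then 1 else if j = 2 then -1 else 0) 0
    (by omega) (by simp)
    (by have := hC 0; have := hC 1; grind)
    (by intro j hj; have := hC j; have := hC (j + 1); have := hC (j + 2); grind)
    (by have := hC m; have := hC (m - 1); have := hC (m + 1); have := hC (m + 2); grind)
    (by have := hC m; have := hC (m + 1); grind)
    (by have := hC m; have := hC (m + 2); grind)
    (by intro j hj; have := hd j; have : j = 0 ∨ j = 1 ∨ 1 < j := by omega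
        grind)
  refine ⟨v, a, b, not_P1 m _ 2 (by omega) hm ?_⟩
  rw [c 2 (by omega)]
  have := hd 2
  simp; omega

/-- Move `2 ω_0 → ω_1` -/
lemma M3 (m : ℕ) (hm : 2 ≤ m) (l : Fin (m + 3) → ℤ) (hd : ∀ j, 0 ≤ X m l j)
    (h0 : 2 ≤ X m l 0) :
    ∃ v, dominant (m + 3) v ∧ prec (m + 3) v l ∧ ¬ P1 m (X m v) := by
  obtain ⟨C, hC⟩ : ∃ C : ℕ → ℕ, ∀ j, (j = 0 → C j = 1) ∧ (0 < j → C j = 0) :=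
    ⟨fun j => if j = 0 then 1 else 0, by grind⟩
  obtain ⟨v, a, b, c⟩ := mv m hm l C (fun j => if j = 0 then 2 else if j = 1 then -1 else 0) 0
    (by omega) (by simp)
    (by have := hC 0; have := hC 1; grind)
    (by intro j hj; have := hC j; have := hC (j + 1); have := hC (j + 2); grind)
    (by have := hC m; have := hC (m - 1); have := hC (m + 1); have := hC (m + 2); grind)
    (by have := hC m; have := hC (m + 1); grind)
    (by have := hC m; have := hC (m + 2); grind)
    (by intro j hj; have := hd j; have : j = 0 ∨ j = 1 ∨ 1 < j := by omega
        grind)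
  refine ⟨v, a, b, not_P1 m _ 1 (by omega) (by omega) ?_⟩
  rw [c 1 (by omega)]
  have := hd 1
  simp; omega

/-- Move `2 ω_s → ω_m` for a spin node `s`. -/
lemma M4 (m : ℕ) (hm : 2 ≤ m) (l : Fin (m + 3) → ℤ) (hd : ∀ j, 0 ≤ X m l j)
    (s : ℕ) (hs : s = m + 1 ∨ s = m + 2) (h0 : 2 ≤ X m l s) :
    ∃ v, dominant (m + 3) v ∧ prec (m + 3) v l ∧ ¬ P1 m (X m v) := by
  obtain ⟨C, hC⟩ : ∃ C : ℕ → ℕ, ∀ j, (j = s → C j = 1) ∧ (j ≠ s → C j = 0) :=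
    ⟨fun j => if j = s then 1 else 0, by grind⟩
  obtain ⟨v, a, b, c⟩ := mv m hm l C (fun j => if j = s then 2 else if j = m then -1 else 0) s
    (by omega) (by simp)
    (by have := hC 0; have := hC 1; grind)
    (by intro j hj; have := hC j; have := hC (j + 1); have := hC (j + 2); grind)
    (by have := hC m; have := hC (m - 1); have := hC (m + 1); have := hC (m + 2); grind)
    (by have := hC m; have := hC (m + 1); grind)
    (by have := hC m; have := hC (m + 2); grind)
    (by intro j hj; have := hd j; grind)
  refine ⟨v, a, b, not_P1 m _ m (by omega) (by omega) ?_⟩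
  have := c m (by omega)
  have := hd m
  grind

/-- Move `ω_{m+1} + ω_{m+2} → ω_{m-1}`. -/
lemma M5 (m : ℕ) (hm : 2 ≤ m) (l : Fin (m + 3) → ℤ) (hd : ∀ j, 0 ≤ X m l j)
    (h0 : 1 ≤ X m l (m + 1)) (h1 : 1 ≤ X m l (m + 2)) :
    ∃ v, dominant (m + 3) v ∧ prec (m + 3) v l ∧ ¬ P1 m (X m v) := by
  obtain ⟨C, hC⟩ : ∃ C : ℕ → ℕ, ∀ j, (m ≤ j → C j = 1) ∧ (j < m → C j = 0) :=
    ⟨fun j => if m ≤ j then 1 else 0, by grind⟩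
  obtain ⟨v, a, b, c⟩ := mv m hm l C (fun j => if m < j then 1 else if j + 1 = m then -1 else 0)
    (m + 1)
    (by omega) (by simp)
    (by have := hC 0; have := hC 1; grind)
    (by intro j hj; have := hC j; have := hC (j + 1); have := hC (j + 2); grind)
    (by have := hC m; have := hC (m - 1); have := hC (m + 1); have := hC (m + 2); grind)
    (by have := hC m; have := hC (m + 1); grind)
    (by have := hC m; have := hC (m + 2); grind)
    (by intro j hj; have := hd j; have : j = m + 1 ∨ j = m + 2 ∨ j ≤ m := by omega
        grind)
  refine ⟨v, a, b, not_P1 m _ (m - 1) (by omega) (by omega) ?_⟩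
  have := c (m - 1) (by omega)
  have := hd (m - 1)
  grind

/-- Move from a node p and a spin node to the previous node and the other spin node. -/
lemma M6 (m : ℕ) (hm : 2 ≤ m) (l : Fin (m + 3) → ℤ) (hd : ∀ j, 0 ≤ X m l j)
    (p s s' : ℕ) (hp : p ≤ 1) (hs : (s = m + 1 ∧ s' = m + 2) ∨ (s = m + 2 ∧ s' = m + 1))
    (h0 : 1 ≤ X m l p) (h1 : 1 ≤ X m l s) :
    ∃ v, dominant (m + 3) v ∧ prec (m + 3) v l ∧ (p = 1 → ¬ P1 m (X m v)) := by
  obtain ⟨C, hC⟩ : ∃ C : ℕ → ℕ, ∀ j, (j < p → C j = 0) ∧ (p ≤ j → j ≤ m → C j = 1) ∧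
      (j = s → C j = 1) ∧ (j = s' → C j = 0) :=
    ⟨fun j => if j < p then 0 else if j = s' then 0 else 1, by grind⟩
  obtain ⟨v, a, b, c⟩ := mv m hm l C (fun j => if j = p ∨ j = s then 1 else
      if j + 1 = p ∨ j = s' then -1 else 0) p
    (by omega) (by simp)
    (by have := hC 0; have := hC 1; grind)
    (by intro j hj; have := hC j; have := hC (j + 1); have := hC (j + 2); grind)
    (by have := hC m; have := hC (m - 1); have := hC (m + 1); have := hC (m + 2); grind)
    (by have := hC m; have := hC (m + 1); grind)
    (by have := hC m; have := hC (m + 2); grind)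
    (by intro j hj; have := hd j; grind)
  refine ⟨v, a, b, ?_⟩
  intro hp1 hP
  have e0 := c 0 (by omega)
  have e1 := c s' (by omega)
  have := hd 0
  have := hd s'
  have q : 1 ≤ X m v 0 ∧ 1 ≤ X m v s' := by grind
  rcases hP with g | g | g | g <;> have g0 := g 0 (by omega) <;> have g1 := g s' (by omega) <;>
    grind

lemma high2 (m : ℕ) (hm : 2 ≤ m) (l : Fin (m + 3) → ℤ) (hd : dominant (m + 3) l)
    (h1 : ¬ P1 m (X m l)) (h2 : ¬ P2 m (X m l)) :
    ∃ v, dominant (m + 3) v ∧ prec (m + 3) v l ∧ ¬ P1 m (X m v) := by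
  rw [dom_iff] at hd
  by_cases c1 : ∃ i, 3 ≤ i ∧ i ≤ m ∧ 1 ≤ X m l i
  · obtain ⟨i, i1, i2, i3⟩ := c1
    obtain ⟨v, a, b, c⟩ := M1 m hm l hd i (by omega) i2 i3
    refine ⟨v, a, b, not_P1 m _ (i - 2) (by omega) (by omega) ?_⟩
    have := c (i - 2) (by omega)
    have := hd (i - 2)
    grind
  have z3 : ∀ j, 3 ≤ j → j ≤ m → X m l j = 0 := by
    intro j a b
    by_contra hne
    exact c1 ⟨j, a, b, by have := hd j; omega⟩
  by_cases c2 : 1 ≤ X m l 2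
  · obtain ⟨v, a, b, c⟩ := M1 m hm l hd 2 (by omega) hm c2
    refine ⟨v, a, b, ?_⟩
    intro hP
    have e0 := c 0 (by omega)
    have := hd 0
    simp at e0
    rcases hP with g | g | g | g
    · have := g 0 (by omega); omega
    · apply h2
      right; left
      intro j hj
      have a1 := g j hj
      have a2 := c j hj
      grind
    · have := g 0 (by omega); grind
    · have := g 0 (by omega); grind
  have x2 : X m l 2 = 0 := by have := hd 2; omega
  by_cases c3 : 1 ≤ X m l 1
  · by_cases d0 : 1 ≤ X m l 0
    · exact M2 m hm l hd d0 c3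
    by_cases d1 : 1 ≤ X m l (m + 1)
    · obtain ⟨v, a, b, c⟩ := M6 m hm l hd 1 (m + 1) (m + 2) le_rfl (by simp) c3 d1
      exact ⟨v, a, b, c rfl⟩
    by_cases d2 : 1 ≤ X m l (m + 2)
    · obtain ⟨v, a, b, c⟩ := M6 m hm l hd 1 (m + 2) (m + 1) le_rfl (by simp) c3 d2
      exact ⟨v, a, b, c rfl⟩
    by_cases d3 : X m l 1 = 1
    · exfalso
      apply h2
      left
      intro j hj
      have := hd j
      have := z3 j
      have : j = 0 ∨ j = 1 ∨ j = 2 ∨ (3 ≤ j ∧ j ≤ m) ∨ j = m + 1 ∨ j = m + 2 := by omega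
      grind
    · obtain ⟨v, a, b, c⟩ := M1 m hm l hd 1 (by omega) (by omega) c3
      refine ⟨v, a, b, not_P1 m _ 1 (by omega) (by omega) ?_⟩
      have := c 1 (by omega)
      grind
  have x1 : X m l 1 = 0 := by have := hd 1; omega
  by_cases d0 : 2 ≤ X m l 0
  · exact M3 m hm l hd d0
  by_cases d1 : 2 ≤ X m l (m + 1)
  · exact M4 m hm l hd _ (by simp) d1
  by_cases d2 : 2 ≤ X m l (m + 2)
  · exact M4 m hm l hd _ (by simp) d2
  by_cases d3 : 1 ≤ X m l (m + 1) ∧ 1 ≤ X m l (m + 2)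
  · exact M5 m hm l hd d3.1 d3.2
  exfalso
  have hall : ∀ j < m + 3, j = 0 ∨ j = m + 1 ∨ j = m + 2 ∨
      (j ≠ 0 ∧ j ≠ m + 1 ∧ j ≠ m + 2 ∧ X m l j = 0) := by
    intro j hj
    have := z3 j
    have : j = 0 ∨ j = 1 ∨ j = 2 ∨ (3 ≤ j ∧ j ≤ m) ∨ j = m + 1 ∨ j = m + 2 := by omega
    grind
  have y0 := hd 0
  have y1 := hd (m + 1)
  have y2 := hd (m + 2)
  have w0 : X m l 0 = 0 ∨ X m l 0 = 1 := by omega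
  have w1 : (X m l (m + 1) = 0 ∧ X m l (m + 2) = 0) ∨ (X m l (m + 1) = 1 ∧ X m l (m + 2) = 0) ∨
      (X m l (m + 1) = 0 ∧ X m l (m + 2) = 1) := by omega
  clear z3 c1 hd
  rcases w0 with w0 | w0 <;> rcases w1 with w1 | w1 | w1
  · exact h1 (Or.inl fun j hj => by rcases hall j hj with rfl | rfl | rfl | f <;> grind)
  · exact h1 (Or.inr (Or.inr (Or.inl fun j hj => by
      rcases hall j hj with rfl | rfl | rfl | f <;> grind)))
  · exact h1 (Or.inr (Or.inr (Or.inr fun j hj => by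
      rcases hall j hj with rfl | rfl | rfl | f <;> grind)))
  · exact h1 (Or.inr (Or.inl fun j hj => by
      rcases hall j hj with rfl | rfl | rfl | f <;> grind))
  · exact h2 (Or.inr (Or.inr (Or.inl fun j hj => by
      rcases hall j hj with rfl | rfl | rfl | f <;> grind)))
  · exact h2 (Or.inr (Or.inr (Or.inr fun j hj => by
      rcases hall j hj with rfl | rfl | rfl | f <;> grind)))

lemma high1 (m : ℕ) (hm : 2 ≤ m) (l : Fin (m + 3) → ℤ) (hd : dominant (m + 3) l)
    (h1 : ¬ P1 m (X m l)) : ∃ v, dominant (m + 3) v ∧ prec (m + 3) v l := by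
  by_cases h2 : P2 m (X m l)
  · rw [dom_iff] at hd
    rcases h2 with g | g | g | g
    · obtain ⟨v, a, b, c⟩ := M1 m hm l hd 1 (by omega) (by omega) (by rw [g 1 (by omega)]; simp)
      exact ⟨v, a, b⟩
    · obtain ⟨v, a, b, c⟩ := M1 m hm l hd 2 (by omega) (by omega) (by rw [g 2 (by omega)]; simp)
      exact ⟨v, a, b⟩
    · obtain ⟨v, a, b, c⟩ := M6 m hm l hd 0 (m + 1) (m + 2) (by omega) (by simp)
        (by rw [g 0 (by omega)]; simp) (by rw [g (m + 1) (by omega)]; simp)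
      exact ⟨v, a, b⟩
    · obtain ⟨v, a, b, c⟩ := M6 m hm l hd 0 (m + 2) (m + 1) (by omega) (by simp)
        (by rw [g 0 (by omega)]; simp) (by rw [g (m + 2) (by omega)]; simp)
      exact ⟨v, a, b⟩
  · obtain ⟨v, a, b, c⟩ := high2 m hm l hd h1 h2
    exact ⟨v, a, b⟩

lemma P1_dom (m : ℕ) (l : Fin (m + 3) → ℤ) (h : P1 m (X m l)) : dominant (m + 3) l := by
  rw [dom_iff]
  intro j
  by_cases hj : j < m + 3
  · rcases h with g | g | g | g <;> rw [g j hj] <;> grind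
  · simp [X, hj]

lemma P2_dom (m : ℕ) (l : Fin (m + 3) → ℤ) (h : P2 m (X m l)) : dominant (m + 3) l := by
  rw [dom_iff]
  intro j
  by_cases hj : j < m + 3
  · rcases h with g | g | g | g <;> rw [g j hj] <;> grind
  · simp [X, hj]

lemma P2_not_P1 (m : ℕ) (hm : 2 ≤ m) (V : ℕ → ℤ) (h : P2 m V) : ¬ P1 m V := by
  rcases h with g | g | g | g
  · exact not_P1 m V 1 le_rfl (by omega) (by rw [g 1 (by omega)]; simp)
  · exact not_P1 m V 2 (by omega) (by omega) (by rw [g 2 (by omega)]; simp)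
  · have a0 := g 0 (by omega)
    have a1 := g (m + 1) (by omega)
    rintro (f | f | f | f) <;> have b0 := f 0 (by omega) <;> have b1 := f (m + 1) (by omega) <;> grind
  · have a0 := g 0 (by omega)
    have a1 := g (m + 2) (by omega)
    rintro (f | f | f | f) <;> have b0 := f 0 (by omega) <;> have b1 := f (m + 2) (by omega) <;> grind

lemma level1_iff (m : ℕ) (hm : 2 ≤ m) (l : Fin (m + 3) → ℤ) :
    (dominant (m + 3) l ∧ ∀ v, dominant (m + 3) v → ¬ prec (m + 3) v l) ↔ P1 m (X m l) := by
  constructor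
  · rintro ⟨hd, h⟩
    by_contra hP
    obtain ⟨v, a, b⟩ := high1 m hm l hd hP
    exact h v a b
  · intro hP
    refine ⟨P1_dom m l hP, fun v hv hp => ?_⟩
    obtain ⟨C, a, b⟩ := prec_data m hm v l hp
    exact low1 m hm C _ _ ((dom_iff m v).1 hv) a b hP

lemma cum1_iff (m : ℕ) (hm : 2 ≤ m) (l : Fin (m + 3) → ℤ) :
    l ∈ cum (m + 3) 1 ↔ P1 m (X m l) := by
  rw [← level1_iff m hm]
  simp [cum]

lemma level2_iff (m : ℕ) (hm : 2 ≤ m) (l : Fin (m + 3) → ℤ) :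
    l ∈ level (m + 3) 2 ↔ P2 m (X m l) := by
  simp only [level, Set.mem_setOf_eq, Nat.add_one_sub_one, show 2 - 1 = 1 from rfl, cum1_iff m hm]
  constructor
  · rintro ⟨hd, hn, h⟩
    by_contra hP
    obtain ⟨v, a, b, c⟩ := high2 m hm l hd hn hP
    exact c (h v a b)
  · intro hP
    refine ⟨P2_dom m l hP, P2_not_P1 m hm _ hP, fun v hv hp => ?_⟩
    obtain ⟨C, a, b⟩ := prec_data m hm v l hp
    exact low2 m hm C _ _ ((dom_iff m v).1 hv) a b hP

/-- **Lemma 5.2, row `D_n` (`n > 4`).** In type `D_n` (`n ≥ 5`):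
`Λ₁ = {0, ω_1, ω_{n-1}, ω_n}` and `Λ₂ = {ω_2, ω_3, ω_1 + ω_{n-1}, ω_1 + ω_n}`. -/
theorem levels_Dn (n : ℕ) (hn : 5 ≤ n) :
    level n 1 =
      {0, Pi.single (⟨0, by omega⟩ : Fin n) (1 : ℤ),
       Pi.single (⟨n - 2, by omega⟩ : Fin n) (1 : ℤ),
       Pi.single (⟨n - 1, by omega⟩ : Fin n) (1 : ℤ)} ∧
    level n 2 =
      {Pi.single (⟨1, by omega⟩ : Fin n) (1 : ℤ),
       Pi.single (⟨2, by omega⟩ : Fin n) (1 : ℤ),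
       Pi.single (⟨0, by omega⟩ : Fin n) (1 : ℤ) +
         Pi.single (⟨n - 2, by omega⟩ : Fin n) (1 : ℤ),
       Pi.single (⟨0, by omega⟩ : Fin n) (1 : ℤ) +
         Pi.single (⟨n - 1, by omega⟩ : Fin n) (1 : ℤ)} := by
  obtain ⟨m, rfl⟩ : ∃ m, n = m + 3 := ⟨n - 3, by omega⟩
  have hm : 2 ≤ m := by omega
  constructor
  · ext l
    have h : l ∈ level (m + 3) 1 ↔ P1 m (X m l) := by
      rw [← level1_iff m hm]
      simp [level, cum]
    rw [h]
    simp only [Set.mem_insert_iff, Set.mem_singleton_iff, X_ext m l, X_single, X_zero, P1]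
    rfl
  · ext l
    rw [level2_iff m hm]
    simp only [Set.mem_insert_iff, Set.mem_singleton_iff, X_ext m l, X_single, X_add, P2]
    rfl

end WeightLevelsDn
end
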